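/- arXiv:1411.0398 — 8 statements merged into one kernel-verified Lean document; each statement's English description precedes it below -/
import Mathlib

section
/- Let U : I → ℝ be a smooth nowhere-vanishing function on an open interval I, let F : I → ℝ be an antiderivative of U, and let α, β, γ ∈ ℝ. Define A(t) = (1/U(t)) e^{−α F(t)}, B(t) = (1/U(t)) e^{−β F(t)}, C(t) = (1/U(t)) e^{−γ F(t)}, and consider the Bianchi I metric g = diag(−1, A(t)², B(t)², C(t)²) on I × ℝ³. Then the vector field ξ with components (1/U(t), α x, β y, γ z) is a conformal Killing vector of g with conformal factor ψ(t) = −U′(t)/U(t)²: for all i,j, ξ^k ∂_k g_{ij} + g_{kj} ∂_i ξ^k + g_{ik} ∂_j ξ^k = 2 ψ g_{ij}. -/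
open Real

/-- Directional (partial) derivative along coordinate `k` on ℝ⁴. -/
noncomputable def pd (k : Fin 4) (f : (Fin 4 → ℝ) → ℝ) (p : Fin 4 → ℝ) : ℝ :=
  fderiv ℝ f p (Pi.single k 1)

/-- Components of the diagonal Bianchi I metric `diag(−1, A(t)², B(t)², C(t)²)`. -/
noncomputable def gmet (A B C : ℝ → ℝ) (p : Fin 4 → ℝ) (i j : Fin 4) : ℝ :=
  if i = j then (![(-1 : ℝ), (A (p 0)) ^ 2, (B (p 0)) ^ 2, (C (p 0)) ^ 2] : Fin 4 → ℝ) i else 0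

lemma pd_time (k : Fin 4) (f : ℝ → ℝ) (f' : ℝ) (p : Fin 4 → ℝ) (h : HasDerivAt f f' (p 0)) :
    pd k (fun q => f (q 0)) p = if k = 0 then f' else 0 := by
  have h0 : HasFDerivAt (fun q : Fin 4 → ℝ => q 0)
      (ContinuousLinearMap.proj (R := ℝ) (φ := fun _ : Fin 4 => ℝ) 0) p :=
    (ContinuousLinearMap.proj (R := ℝ) (φ := fun _ : Fin 4 => ℝ) 0).hasFDerivAt
  have h1 : HasFDerivAt (fun q : Fin 4 → ℝ => f (q 0)) _ p := h.comp_hasFDerivAt p h0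
  unfold pd
  rw [h1.fderiv]
  fin_cases k <;> simp

lemma pd_lin (k m : Fin 4) (c : ℝ) (p : Fin 4 → ℝ) :
    pd k (fun q => c * q m) p = if k = m then c else 0 := by
  have h0 : HasFDerivAt (fun q : Fin 4 → ℝ => q m)
      (ContinuousLinearMap.proj (R := ℝ) (φ := fun _ : Fin 4 => ℝ) m) p :=
    (ContinuousLinearMap.proj (R := ℝ) (φ := fun _ : Fin 4 => ℝ) m).hasFDerivAt
  have h1 := h0.const_mul c
  unfold pd
  rw [h1.fderiv]
  fin_cases k <;> fin_cases m <;> simp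

lemma pd_const (k : Fin 4) (c : ℝ) (p : Fin 4 → ℝ) : pd k (fun _ => c) p = 0 := by
  unfold pd
  simp

lemma scale_deriv (U F A : ℝ → ℝ) (t α u' : ℝ) (hU : HasDerivAt U u' t) (h0 : U t ≠ 0)
    (hF : HasDerivAt F (U t) t) (hA : ∀ t, A t = (1 / U t) * Real.exp (-(α * F t))) :
    HasDerivAt (fun s => A s ^ 2) (2 * A t ^ 2 * (-u' / U t - α * U t)) t := by
  have e : A = fun t => (U t)⁻¹ * Real.exp (-(α * F t)) := by
    funext s
    rw [hA, one_div]
  have h := (((hU.inv h0).mul ((hF.const_mul α).neg.exp)).pow 2)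
  subst e
  refine h.congr_deriv ?_
  simp
  field_simp
  try ring

/-- if `A = (1/U) e^{−αF}`, `B = (1/U) e^{−βF}`, `C = (1/U) e^{−γF}` with `F′ = U`
on an open interval, then `ξ = (1/U, αx, βy, γz)` is a conformal Killing vector of the Bianchi I
metric `diag(−1, A², B², C²)` with conformal factor `ψ = −U′/U²`. -/
theorem stmt1 (a b : ℝ) (U F : ℝ → ℝ)
    (hU : ContDiffOn ℝ (⊤ : ℕ∞) U (Set.Ioo a b))
    (hU0 : ∀ t ∈ Set.Ioo a b, U t ≠ 0)
    (hF : ∀ t ∈ Set.Ioo a b, HasDerivAt F (U t) t)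
    (α β γ : ℝ) (A B C : ℝ → ℝ)
    (hA : ∀ t, A t = (1 / U t) * Real.exp (-(α * F t)))
    (hB : ∀ t, B t = (1 / U t) * Real.exp (-(β * F t)))
    (hC : ∀ t, C t = (1 / U t) * Real.exp (-(γ * F t))) :
    ∀ (i j : Fin 4) (p : Fin 4 → ℝ), p 0 ∈ Set.Ioo a b →
      (∑ k : Fin 4,
        ((![1 / U (p 0), α * p 1, β * p 2, γ * p 3] : Fin 4 → ℝ) k
            * pd k (fun q => gmet A B C q i j) p
          + gmet A B C p k j
            * pd i (fun q => (![1 / U (q 0), α * q 1, β * q 2, γ * q 3] : Fin 4 → ℝ) k) p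
          + gmet A B C p i k
            * pd j (fun q => (![1 / U (q 0), α * q 1, β * q 2, γ * q 3] : Fin 4 → ℝ) k) p))
      = 2 * (-(deriv U (p 0)) / (U (p 0)) ^ 2) * gmet A B C p i j := by
  intro i j p hp
  have h0 := hU0 _ hp
  have hu : HasDerivAt U (deriv U (p 0)) (p 0) :=
    ((hU.contDiffAt (Ioo_mem_nhds hp.1 hp.2)).differentiableAt (by simp)).hasDerivAt
  have dA := fun k => pd_time k _ _ p (scale_deriv U F A _ α _ hu h0 (hF _ hp) hA)
  have dB := fun k => pd_time k _ _ p (scale_deriv U F B _ β _ hu h0 (hF _ hp) hB)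
  have dC := fun k => pd_time k _ _ p (scale_deriv U F C _ γ _ hu h0 (hF _ hp) hC)
  have dU := fun k => pd_time k (fun t => (U t)⁻¹) _ p (hu.inv h0)
  clear hA hB hC
  fin_cases i <;> fin_cases j <;>
    simp [Fin.sum_univ_four, gmet, pd_lin, pd_const, dA, dB, dC, dU] <;>
    (try field_simp) <;> (try ring)
end

section
/- Let U : I → ℝ be a smooth nowhere-vanishing function on an open interval I, let L = 1/U, let F be an antiderivative of U, let α, β, γ ∈ ℝ with M = α + β + γ, and set A(t) = L(t) e^{−α F(t)}, B(t) = L(t) e^{−β F(t)}, C(t) = L(t) e^{−γ F(t)}. For the Bianchi I metric g = diag(−1, A², B², C²), the Laplace–Beltrami operator applied to a function f of t only equals Δf = −f″ − (A′/A + B′/B + C′/C) f′. Then for ψ(t) = L′(t) (= −U′/U²), and for each t ∈ I, Δψ(t) = 0 if and only if L(t) L‴(t) + (3 L′(t) − M) L″(t) = 0. -/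
open Real

/-- for the Bianchi I metric `diag(−1, A², B², C²)` with
`A = L e^{−αF}`, `B = L e^{−βF}`, `C = L e^{−γF}`, `L = 1/U`, `F′ = U`, and `ψ = L′`,
the Laplace–Beltrami expression `Δψ = −ψ″ − (A′/A + B′/B + C′/C) ψ′` vanishes at `t`
iff `L L‴ + (3L′ − M) L″ = 0` at `t`, where `M = α + β + γ`. -/
theorem stmt2 (a b : ℝ) (U F L : ℝ → ℝ)
    (hU : ContDiffOn ℝ (⊤ : ℕ∞) U (Set.Ioo a b))
    (hU0 : ∀ t ∈ Set.Ioo a b, U t ≠ 0)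
    (hL : ∀ t, L t = 1 / U t)
    (hF : ∀ t ∈ Set.Ioo a b, HasDerivAt F (U t) t)
    (α β γ M : ℝ) (hM : M = α + β + γ)
    (A B C : ℝ → ℝ)
    (hA : ∀ t, A t = L t * Real.exp (-(α * F t)))
    (hB : ∀ t, B t = L t * Real.exp (-(β * F t)))
    (hC : ∀ t, C t = L t * Real.exp (-(γ * F t))) :
    ∀ t ∈ Set.Ioo a b,
      (-(deriv (deriv (deriv L)) t)
          - (deriv A t / A t + deriv B t / B t + deriv C t / C t) * deriv (deriv L) t = 0)
      ↔ (L t * deriv (deriv (deriv L)) t + (3 * deriv L t - M) * deriv (deriv L) t = 0) := by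
  intro t ht
  have hUd : DifferentiableAt ℝ U t :=
    (hU.differentiableOn (by simp)).differentiableAt (isOpen_Ioo.mem_nhds ht)
  have hu := hU0 t ht
  have hLd : DifferentiableAt ℝ L t := by
    have h : L = fun s => 1 / U s := funext hL
    rw [h]
    exact (differentiableAt_const _).div hUd hu
  have hL0 : L t ≠ 0 := by rw [hL]; exact one_div_ne_zero hu
  have key : ∀ (c : ℝ) (G : ℝ → ℝ), (∀ t, G t = L t * Real.exp (-(c * F t))) →
      deriv G t / G t = (deriv L t - c) / L t := by
    intro c G hG
    have h1 : HasDerivAt G (deriv L t * Real.exp (-(c * F t))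
        + L t * (Real.exp (-(c * F t)) * (-(c * U t)))) t := by
      have h : G = fun s => L s * Real.exp (-(c * F s)) := funext hG
      rw [h]
      exact hLd.hasDerivAt.mul (((hF t ht).const_mul c).neg.exp)
    have he := Real.exp_ne_zero (-(c * F t))
    have hLU : L t * U t = 1 := by rw [hL]; field_simp
    rw [h1.deriv, hG t, div_eq_div_iff (mul_ne_zero hL0 he) hL0]
    linear_combination (-(c * L t * Real.exp (-(c * F t)))) * hLU
  rw [key α A hA, key β B hB, key γ C hC, hM]
  have e : L t * deriv (deriv (deriv L)) t
        + (3 * deriv L t - (α + β + γ)) * deriv (deriv L) t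
      = -L t * (-(deriv (deriv (deriv L)) t) - ((deriv L t - α) / L t + (deriv L t - β) / L t
        + (deriv L t - γ) / L t) * deriv (deriv L) t) := by
    field_simp
    ring
  rw [e, mul_eq_zero, neg_eq_zero]
  simp only [hL0, false_or]
end

section
/- On the region 0 < t < π/2 of ℝ⁴ with coordinates (t,x,y,z), consider the vector fields Ȳ⁴ = e^{x+y}(1, −cot t, tan t, 0), Ȳ⁵ = e^{x−y}(1, −cot t, −tan t, 0), Ȳ⁶ = e^{−x+y}(1, cot t, tan t, 0), Ȳ⁷ = e^{−x−y}(1, cot t, −tan t, 0), and Y¹ = ∂_x, Y² = ∂_y. Then the Lie brackets satisfy [Ȳ⁴, Ȳ⁷] = −4(Y¹ + Y²) and [Ȳ⁵, Ȳ⁶] = 4(−Y¹ + Y²). -/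
open Real

/-- Lie bracket of vector fields on (an open subset of) ℝ⁴:
`[X,Y]^i = X^j ∂_j Y^i − Y^j ∂_j X^i`. -/
noncomputable def lieBracket (X Y : (Fin 4 → ℝ) → Fin 4 → ℝ) (p : Fin 4 → ℝ) (i : Fin 4) : ℝ :=
  ∑ j : Fin 4, (X p j * pd j (fun q => Y q i) p - Y p j * pd j (fun q => X q i) p)

/-- `Ȳ⁴ = e^{x+y}(1, −cot t, tan t, 0)`. -/
noncomputable def Y4 (q : Fin 4 → ℝ) : Fin 4 → ℝ :=
  fun k => Real.exp (q 1 + q 2) *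
    (![(1 : ℝ), -Real.cot (q 0), Real.tan (q 0), 0] : Fin 4 → ℝ) k

/-- `Ȳ⁵ = e^{x−y}(1, −cot t, −tan t, 0)`. -/
noncomputable def Y5 (q : Fin 4 → ℝ) : Fin 4 → ℝ :=
  fun k => Real.exp (q 1 - q 2) *
    (![(1 : ℝ), -Real.cot (q 0), -Real.tan (q 0), 0] : Fin 4 → ℝ) k

/-- `Ȳ⁶ = e^{−x+y}(1, cot t, tan t, 0)`. -/
noncomputable def Y6 (q : Fin 4 → ℝ) : Fin 4 → ℝ :=
  fun k => Real.exp (-q 1 + q 2) *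
    (![(1 : ℝ), Real.cot (q 0), Real.tan (q 0), 0] : Fin 4 → ℝ) k

/-- `Ȳ⁷ = e^{−x−y}(1, cot t, −tan t, 0)`. -/
noncomputable def Y7 (q : Fin 4 → ℝ) : Fin 4 → ℝ :=
  fun k => Real.exp (-q 1 - q 2) *
    (![(1 : ℝ), Real.cot (q 0), -Real.tan (q 0), 0] : Fin 4 → ℝ) k

/-- `Y¹ = ∂_x`. -/
noncomputable def Y1 (_q : Fin 4 → ℝ) : Fin 4 → ℝ := ![(0 : ℝ), 1, 0, 0]

/-- `Y² = ∂_y`. -/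
noncomputable def Y2 (_q : Fin 4 → ℝ) : Fin 4 → ℝ := ![(0 : ℝ), 0, 1, 0]

lemma pd_aux (a b : ℝ) (f : ℝ → ℝ) (f' : ℝ) (p : Fin 4 → ℝ) (hf : HasDerivAt f f' (p 0))
    (k : Fin 4) :
    pd k (fun q => Real.exp (a * q 1 + b * q 2) * f (q 0)) p =
      Real.exp (a * p 1 + b * p 2) *
        (![f', a * f (p 0), b * f (p 0), 0] : Fin 4 → ℝ) k := by
  have hp : ∀ i : Fin 4, HasFDerivAt (fun q : Fin 4 → ℝ => q i)
      (ContinuousLinearMap.proj (R := ℝ) (φ := fun _ : Fin 4 => ℝ) i) p :=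
    fun i => hasFDerivAt_apply i p
  have h1 := ((((hp 1).const_mul a).add ((hp 2).const_mul b)).exp).mul
    (hf.comp_hasFDerivAt p (hp 0))
  have h2 : fderiv ℝ (fun q : Fin 4 → ℝ => Real.exp (a * q 1 + b * q 2) * f (q 0)) p = _ :=
    h1.fderiv
  rw [pd, h2]
  fin_cases k <;> simp [Pi.single_apply] <;> ring

lemma lb_aux (a b c T c' T' s1 s2 s3 s4 : ℝ) (C D : ℝ → ℝ) (p : Fin 4 → ℝ)
    (hC : HasDerivAt C c' (p 0)) (hD : HasDerivAt D T' (p 0)) (hc : C (p 0) = c)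
    (hT : D (p 0) = T) (X Y : (Fin 4 → ℝ) → Fin 4 → ℝ)
    (hX : X = fun q k => Real.exp (a * q 1 + b * q 2) *
      (![1, s1 * C (q 0), s2 * D (q 0), 0] : Fin 4 → ℝ) k)
    (hY : Y = fun q k => Real.exp (-a * q 1 + -b * q 2) *
      (![1, s3 * C (q 0), s4 * D (q 0), 0] : Fin 4 → ℝ) k) (i : Fin 4) :
    lieBracket X Y p i = (![-(a * s1 * c + b * s2 * T) - (a * s3 * c + b * s4 * T),
      -(a * s1 * c + b * s2 * T) * (s3 * c) - (a * s3 * c + b * s4 * T) * (s1 * c)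
        + (s3 - s1) * c',
      -(a * s1 * c + b * s2 * T) * (s4 * T) - (a * s3 * c + b * s4 * T) * (s2 * T)
        + (s4 - s2) * T', 0] : Fin 4 → ℝ) i := by
  have he : Real.exp (a * p 1 + b * p 2) * Real.exp (-a * p 1 + -b * p 2) = 1 := by
    rw [← Real.exp_add, ← Real.exp_zero]; congr 1; ring
  have k1 := fun a b => pd_aux a b (fun _ => 1) 0 p (hasDerivAt_const _ _)
  have k0 := fun a b => pd_aux a b (fun _ => 0) 0 p (hasDerivAt_const _ _)
  have kC := fun a b s => pd_aux a b (fun t => s * C t) _ p (hC.const_mul s)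
  have kD := fun a b s => pd_aux a b (fun t => s * D t) _ p (hD.const_mul s)
  subst hX hY hc hT
  generalize hE : Real.exp (a * p 1 + b * p 2) = E at *
  generalize hF : Real.exp (-a * p 1 + -b * p 2) = F at *
  fin_cases i
  · simp only [lieBracket, Fin.sum_univ_four]
    simp [-neg_mul, -mul_one, k1, hE, hF]
    linear_combination (-(a * s1 * C (p 0) + b * s2 * D (p 0)) - (a * s3 * C (p 0) + b * s4 * D (p 0))) * he
  · simp only [lieBracket, Fin.sum_univ_four]
    simp [-neg_mul, kC, hE, hF]
    linear_combination (-(a * s1 * C (p 0) + b * s2 * D (p 0)) * (s3 * C (p 0)) - (a * s3 * C (p 0) + b * s4 * D (p 0)) * (s1 * C (p 0)) + (s3 - s1) * c') * he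
  · simp only [lieBracket, Fin.sum_univ_four]
    simp [-neg_mul, kD, hE, hF]
    linear_combination (-(a * s1 * C (p 0) + b * s2 * D (p 0)) * (s4 * D (p 0)) - (a * s3 * C (p 0) + b * s4 * D (p 0)) * (s2 * D (p 0)) + (s4 - s2) * T') * he
  · simp [lieBracket, Fin.sum_univ_four, pd]

/-- on `0 < t < π/2`, the Lie brackets satisfy
`[Ȳ⁴, Ȳ⁷] = −4(Y¹ + Y²)` and `[Ȳ⁵, Ȳ⁶] = 4(−Y¹ + Y²)`. -/
theorem stmt7 :
    ∀ (p : Fin 4 → ℝ), p 0 ∈ Set.Ioo 0 (π / 2) → ∀ i : Fin 4,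
      lieBracket Y4 Y7 p i = -4 * (Y1 p i + Y2 p i) ∧
      lieBracket Y5 Y6 p i = 4 * (-(Y1 p i) + Y2 p i) := by
  intro p hp i
  have hs : Real.sin (p 0) ≠ 0 :=
    (Real.sin_pos_of_pos_of_lt_pi hp.1 (by linarith [hp.2, Real.pi_pos])).ne'
  have hc : Real.cos (p 0) ≠ 0 :=
    (Real.cos_pos_of_mem_Ioo ⟨by linarith [hp.1, Real.pi_pos], hp.2⟩).ne'
  have hsc := Real.sin_sq_add_cos_sq (p 0)
  have hD : HasDerivAt Real.tan (1 + Real.tan (p 0) ^ 2) (p 0) := by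
    convert Real.hasDerivAt_tan hc using 1
    rw [Real.tan_eq_sin_div_cos]; field_simp; linarith
  have hC : HasDerivAt Real.cot (-(1 + Real.cot (p 0) ^ 2)) (p 0) := by
    have h := (Real.hasDerivAt_cos (p 0)).div (Real.hasDerivAt_sin (p 0)) hs
    have h' : Real.cot = Real.cos / Real.sin := by
      funext t; simp [Real.cot_eq_cos_div_sin]
    have e : (-Real.sin (p 0) * Real.sin (p 0) - Real.cos (p 0) * Real.cos (p 0)) /
        Real.sin (p 0) ^ 2 = -(1 + Real.cot (p 0) ^ 2) := by
      rw [Real.cot_eq_cos_div_sin]; field_simp; ring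
    rw [← e, h']
    exact h
  have hm : Real.cot (p 0) * Real.tan (p 0) = 1 := by
    rw [Real.tan_eq_sin_div_cos, Real.cot_eq_cos_div_sin]; field_simp
  constructor
  · rw [lb_aux 1 1 _ _ _ _ (-1) 1 1 (-1) _ _ p hC hD rfl rfl Y4 Y7
      (by funext q k; simp [Y4]) (by funext q k; simp [Y7, sub_eq_add_neg])]
    fin_cases i <;> simp [Y1, Y2]
    · ring
    · linear_combination (-2) * hm
    · linear_combination (-2) * hm
  · rw [lb_aux 1 (-1) _ _ _ _ (-1) (-1) 1 1 _ _ p hC hD rfl rfl Y5 Y6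
      (by funext q k; simp [Y5, sub_eq_add_neg]) (by funext q k; simp [Y6])]
    fin_cases i <;> simp [Y1, Y2]
    · ring
    · linear_combination (-2) * hm
    · linear_combination 2 * hm
end

section
/- Let a, b, c ∈ ℝ and let F : ℝ³ → ℝ be smooth. Then the potential V(t,x,y,z) = F(t, x, (c/2)(y² + z²) − (b y − a z)) satisfies identically on ℝ⁴ the constraint a ∂_y V + b ∂_z V + c (z ∂_y V − y ∂_z V) = 0; that is, V is invariant along the Killing vector a Y² + b Y³ + c Y⁴, where Y² = ∂_y, Y³ = ∂_z and Y⁴ = z∂_y − y∂_z. -/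
open Real

/-- the potential `V = F(t, x, (c/2)(y²+z²) − (by − az))` satisfies
`a ∂_y V + b ∂_z V + c (z ∂_y V − y ∂_z V) = 0` identically, i.e. it is invariant along
the Killing vector `aY² + bY³ + cY⁴` with `Y² = ∂_y`, `Y³ = ∂_z`, `Y⁴ = z∂_y − y∂_z`. -/
theorem stmt10 (a b c : ℝ) (F : (Fin 3 → ℝ) → ℝ) (hF : ContDiff ℝ (⊤ : ℕ∞) F)
    (V : (Fin 4 → ℝ) → ℝ)
    (hV : ∀ p : Fin 4 → ℝ,
      V p = F ![p 0, p 1, c / 2 * ((p 2) ^ 2 + (p 3) ^ 2) - (b * p 2 - a * p 3)]) :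
    ∀ p : Fin 4 → ℝ,
      a * pd 2 V p + b * pd 3 V p + c * (p 3 * pd 2 V p - p 2 * pd 3 V p) = 0 := by
  intro p
  obtain ⟨G, hG⟩ : ∃ G : (Fin 4 → ℝ) → (Fin 3 → ℝ), G = fun p =>
    ![p 0, p 1, c / 2 * ((p 2) ^ 2 + (p 3) ^ 2) - (b * p 2 - a * p 3)] := ⟨_, rfl⟩
  have hVG : V = F ∘ G := by
    funext q
    simp [hG, hV q]
  have hFd : DifferentiableAt ℝ F (G p) := (hF.differentiable (by simp)).differentiableAt
  have hGd : DifferentiableAt ℝ G p := by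
    rw [hG, differentiableAt_pi]
    intro i
    fin_cases i <;> simp <;> fun_prop
  have hpd : ∀ k, pd k V p = fderiv ℝ F (G p) (fderiv ℝ G p (Pi.single k 1)) := by
    intro k
    rw [pd, hVG, fderiv_comp p hFd hGd]
    rfl
  have pr : ∀ i : Fin 4, HasFDerivAt (fun q : Fin 4 → ℝ => q i)
      (ContinuousLinearMap.proj (R := ℝ) (φ := fun _ : Fin 4 => ℝ) i) p :=
    fun i => hasFDerivAt_apply i p
  have hcomp : ∀ (i : Fin 3) (v : Fin 4 → ℝ),
      fderiv ℝ G p v i = fderiv ℝ (fun q => G q i) p v := by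
    intro i v
    have h := hasFDerivAt_pi'.1 hGd.hasFDerivAt i
    rw [h.fderiv]
    rfl
  have h0 : ∀ v : Fin 4 → ℝ, fderiv ℝ G p v 0 = v 0 := by
    intro v
    rw [hcomp]
    have : (fun q => G q 0) = fun q : Fin 4 → ℝ => q 0 := by funext q; simp [hG]
    rw [this, (pr 0).fderiv]
    rfl
  have h1 : ∀ v : Fin 4 → ℝ, fderiv ℝ G p v 1 = v 1 := by
    intro v
    rw [hcomp]
    have : (fun q => G q 1) = fun q : Fin 4 → ℝ => q 1 := by funext q; simp [hG]
    rw [this, (pr 1).fderiv]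
    rfl
  have h2 : ∀ v : Fin 4 → ℝ, fderiv ℝ G p v 2 =
      (c * p 2 - b) * v 2 + (c * p 3 + a) * v 3 := by
    intro v
    rw [hcomp]
    have : (fun q => G q 2) = fun q : Fin 4 → ℝ =>
        c / 2 * ((q 2) ^ 2 + (q 3) ^ 2) - (b * q 2 - a * q 3) := by funext q; simp [hG]
    have hd := (((((pr 2).pow 2).add ((pr 3).pow 2)).const_mul (c / 2)).sub
      (((pr 2).const_mul b).sub ((pr 3).const_mul a))).fderiv
    rw [this]
    refine (congrArg (fun L : (Fin 4 → ℝ) →L[ℝ] ℝ => L v) hd).trans ?_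
    simp
    ring
  have key : (a + c * p 3) • fderiv ℝ G p (Pi.single 2 1)
      + (b - c * p 2) • fderiv ℝ G p (Pi.single 3 1) = 0 := by
    funext i
    fin_cases i
    · simp [h0]
    · simp [h1]
    · simp [h2]
      ring
  have := congrArg (fderiv ℝ F (G p)) key
  rw [map_add, map_smul, map_smul, map_zero, ← hpd, ← hpd, smul_eq_mul, smul_eq_mul] at this
  linarith
end

section
/- Let U : I → ℝ be a smooth nowhere-vanishing function on an open interval I, let F be an antiderivative of U, let α, β, γ ∈ ℝ, and let V̄ : ℝ³ → ℝ be smooth. Define on I × ℝ³ the potential V(t,x,y,z) = U(t)² V̄(x e^{−α F(t)}, y e^{−β F(t)}, z e^{−γ F(t)}), the vector field ξ = (1/U(t), α x, β y, γ z), and the function ψ(t) = −U′(t)/U(t)². Then the identity ξ^k ∂_k V + 2 ψ V = 0 holds everywhere on I × ℝ³. (This is the Lie/Noether point symmetry constraint ξ^k V_{,k} + 2ψV − ((2−n)/2)Δψ = 0 of the four-dimensional Klein–Gordon equation for the conformal Killing vector ξ in the case Δψ = 0.) -/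
open Real

theorem aux_coord (F : ℝ → ℝ) (u c : ℝ) (i : Fin 4) (p : Fin 4 → ℝ) (hF : HasDerivAt F u (p 0)) :
    ∃ L : (Fin 4 → ℝ) →L[ℝ] ℝ,
      HasFDerivAt (fun q : Fin 4 → ℝ => q i * Real.exp (-(c * F (q 0)))) L p ∧
      ∀ v, L v = (v i - p i * c * u * v 0) * Real.exp (-(c * F (p 0))) := by
  have h0 : HasFDerivAt (fun q : Fin 4 → ℝ => q 0) (ContinuousLinearMap.proj (R := ℝ) (φ := fun _ : Fin 4 => ℝ) 0) p :=
    hasFDerivAt_apply 0 p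
  have hi : HasFDerivAt (fun q : Fin 4 → ℝ => q i) (ContinuousLinearMap.proj (R := ℝ) (φ := fun _ : Fin 4 => ℝ) i) p :=
    hasFDerivAt_apply i p
  have hE : HasDerivAt (fun t => Real.exp (-(c * F t))) (Real.exp (-(c * F (p 0))) * (-(c * u))) (p 0) :=
    ((hF.const_mul c).neg).exp
  have hE2 := hE.comp_hasFDerivAt p h0
  refine ⟨_, hi.mul hE2, ?_⟩
  intro v
  simp
  ring

/-- for the potential `V = U(t)² V̄(x e^{−αF(t)}, y e^{−βF(t)}, z e^{−γF(t)})`,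
the CKV `ξ = (1/U, αx, βy, γz)` with conformal factor `ψ = −U′/U²` satisfies the Lie/Noether
symmetry constraint `ξ^k ∂_k V + 2ψV = 0` on `I × ℝ³`. -/
theorem stmt13 (a b : ℝ) (U F : ℝ → ℝ)
    (hU : ContDiffOn ℝ (⊤ : ℕ∞) U (Set.Ioo a b))
    (hU0 : ∀ t ∈ Set.Ioo a b, U t ≠ 0)
    (hF : ∀ t ∈ Set.Ioo a b, HasDerivAt F (U t) t)
    (α β γ : ℝ) (Vbar : (Fin 3 → ℝ) → ℝ) (hVbar : ContDiff ℝ (⊤ : ℕ∞) Vbar)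
    (V : (Fin 4 → ℝ) → ℝ)
    (hV : ∀ p : Fin 4 → ℝ,
      V p = (U (p 0)) ^ 2 * Vbar ![p 1 * Real.exp (-(α * F (p 0))),
        p 2 * Real.exp (-(β * F (p 0))), p 3 * Real.exp (-(γ * F (p 0)))]) :
    ∀ p : Fin 4 → ℝ, p 0 ∈ Set.Ioo a b →
      (∑ k : Fin 4, (![1 / U (p 0), α * p 1, β * p 2, γ * p 3] : Fin 4 → ℝ) k * pd k V p)
        + 2 * (-(deriv U (p 0)) / (U (p 0)) ^ 2) * V p = 0 := by
  intro p hp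
  have hu := hU0 _ hp
  have hUd : HasDerivAt U (deriv U (p 0)) (p 0) :=
    ((hU.contDiffAt (isOpen_Ioo.mem_nhds hp)).differentiableAt (by simp)).hasDerivAt
  obtain ⟨L1, h1, e1⟩ := aux_coord F _ α 1 p (hF _ hp)
  obtain ⟨L2, h2, e2⟩ := aux_coord F _ β 2 p (hF _ hp)
  obtain ⟨L3, h3, e3⟩ := aux_coord F _ γ 3 p (hF _ hp)
  have h0 : HasFDerivAt (fun q : Fin 4 → ℝ => q 0) (ContinuousLinearMap.proj (R := ℝ) (φ := fun _ : Fin 4 => ℝ) 0) p :=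
    hasFDerivAt_apply 0 p
  have hU2 := (hUd.pow 2).comp_hasFDerivAt p h0
  have hG : HasFDerivAt (fun q : Fin 4 → ℝ => (![q 1 * Real.exp (-(α * F (q 0))),
        q 2 * Real.exp (-(β * F (q 0))), q 3 * Real.exp (-(γ * F (q 0)))] : Fin 3 → ℝ))
      (ContinuousLinearMap.pi ![L1, L2, L3]) p := by
    rw [hasFDerivAt_pi']
    intro i
    fin_cases i
    · exact h1
    · exact h2
    · exact h3
  have hB := ((hVbar.differentiable (by simp)) ![p 1 * Real.exp (-(α * F (p 0))),
        p 2 * Real.exp (-(β * F (p 0))), p 3 * Real.exp (-(γ * F (p 0)))]).hasFDerivAt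
  have hBG := HasFDerivAt.comp p hB hG
  have hT := hU2.mul hBG
  set ξ : Fin 4 → ℝ := ![1 / U (p 0), α * p 1, β * p 2, γ * p 3] with hξ
  have hsum : (∑ k : Fin 4, ξ k * pd k V p) = fderiv ℝ V p ξ := by
    conv_rhs => rw [pi_eq_sum_univ' ξ]
    simp only [map_sum, map_smul, smul_eq_mul, pd]
  have hz : ContinuousLinearMap.pi ![L1, L2, L3] ξ = 0 := by
    ext i
    fin_cases i
    · simp [e1, hξ]; field_simp; ring
    · simp [e2, hξ]; field_simp; ring
    · simp [e3, hξ]; field_simp; ring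
  have hVd := (hT.congr_of_eventuallyEq (Filter.Eventually.of_forall hV)).fderiv
  rw [hsum, hVd, hV p]
  simp only [ContinuousLinearMap.add_apply, ContinuousLinearMap.smul_apply, ContinuousLinearMap.comp_apply, hz, map_zero]
  simp [hξ]
  field_simp
  ring
end

section
/- Let β, μ₁, μ₄, μ₅ ∈ ℝ and let W : ℝ → ℝ and σ : (0,∞) → ℝ be smooth. On the region D = {(t,x,y,z) : t > 0, y > 0} consider the Klein–Gordon equation of the Bianchi I metric g = diag(−1, t², t^{2−2β}, t^{2−2β}): −u_{tt} + t^{−2} u_{xx} + t^{2β−2}(u_{yy} + u_{zz}) − ((3 − 2β)/t) u_t + t^{−2} W((y² + z²)/t^{2β}) u = 0. Define u(t,x,y,z) = t^{μ₅} exp(μ₁ x + μ₄ arctan(z/y)) σ(√(y² + z²)/t^{β}). Then u satisfies the Klein–Gordon equation on D if and only if σ satisfies, for all ζ > 0, the reduced ordinary differential equation (1 − β² ζ²) σ″(ζ) + (1/ζ + β ζ (2 + 2μ₅ − 3β)) σ′(ζ) + (μ₅(2β − 2 − μ₅) + μ₁² + μ₄²/ζ² + W(ζ²)) σ(ζ)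 = 0. -/
open Real

noncomputable def bz (β : ℝ) (p : Fin 4 → ℝ) : ℝ :=
  Real.sqrt ((p 2) ^ 2 + (p 3) ^ 2) / (p 0) ^ β

noncomputable def bk (β μ₁ μ₄ m : ℝ) (τ : ℝ → ℝ) (p : Fin 4 → ℝ) : ℝ :=
  (p 0) ^ m * Real.exp (μ₁ * p 1 + μ₄ * Real.arctan (p 3 / p 2)) * τ (bz β p)

lemma bz_pos (β : ℝ) (p : Fin 4 → ℝ) (h0 : 0 < p 0) (h2 : 0 < p 2) : 0 < bz β p := by
  unfold bz; positivity

lemma dom_open (p : Fin 4 → ℝ) (h0 : 0 < p 0) (h2 : 0 < p 2) :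
    ∀ᶠ q : Fin 4 → ℝ in nhds p, 0 < q 0 ∧ 0 < q 2 :=
  ((continuous_apply 0).continuousAt.eventually (lt_mem_nhds h0)).and
    ((continuous_apply 2).continuousAt.eventually (lt_mem_nhds h2))

lemma bz_diff (β : ℝ) (p : Fin 4 → ℝ) (h0 : 0 < p 0) (h2 : 0 < p 2) :
    DifferentiableAt ℝ (bz β) p := by
  unfold bz
  have : (p 2) ^ 2 + (p 3) ^ 2 ≠ 0 := by positivity
  have : (p 0) ^ β ≠ 0 := by positivity
  have hr : DifferentiableAt ℝ (fun q : Fin 4 → ℝ => (q 0) ^ β) p :=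
    DifferentiableAt.rpow_const (by fun_prop) (Or.inl h0.ne')
  have hs : DifferentiableAt ℝ (fun q : Fin 4 → ℝ => Real.sqrt ((q 2) ^ 2 + (q 3) ^ 2)) p :=
    DifferentiableAt.sqrt (by fun_prop) (by assumption)
  exact (by simpa only [div_eq_mul_inv] using hs.fun_mul (hr.fun_inv (by assumption)))

lemma bk_diff (β μ₁ μ₄ m : ℝ) (τ : ℝ → ℝ) (p : Fin 4 → ℝ) (h0 : 0 < p 0) (h2 : 0 < p 2)
    (hτ : DifferentiableAt ℝ τ (bz β p)) : DifferentiableAt ℝ (bk β μ₁ μ₄ m τ) p := by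
  unfold bk
  have hr : DifferentiableAt ℝ (fun q : Fin 4 → ℝ => (q 0) ^ m) p :=
    DifferentiableAt.rpow_const (by fun_prop) (Or.inl h0.ne')
  have hd : DifferentiableAt ℝ (fun q : Fin 4 → ℝ => q 3 / q 2) p :=
    by fun_prop (disch := exact h2.ne')
  have hc : DifferentiableAt ℝ (fun q : Fin 4 → ℝ => τ (bz β q)) p :=
    DifferentiableAt.comp p hτ (bz_diff β p h0 h2)
  have he : DifferentiableAt ℝ (fun q : Fin 4 → ℝ =>
      Real.exp (μ₁ * q 1 + μ₄ * Real.arctan (q 3 / q 2))) p := by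
    apply DifferentiableAt.exp
    have := hd.arctan
    fun_prop
  exact (hr.fun_mul he).fun_mul hc

lemma pd_eq (k : Fin 4) (f : (Fin 4 → ℝ) → ℝ) (p : Fin 4 → ℝ) (d : ℝ)
    (hf : DifferentiableAt ℝ f p)
    (h : HasDerivAt (fun s => f (Function.update p k s)) d (p k)) : pd k f p = d := by
  have h1 : HasDerivAt (fun s => f (Function.update p k s)) (fderiv ℝ f p (Pi.single k 1)) (p k) := by
    have hu := hasDerivAt_update p k (p k)
    have hf' : HasFDerivAt f (fderiv ℝ f p) (Function.update p k (p k)) := by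
      simpa using hf.hasFDerivAt
    exact hf'.comp_hasDerivAt (p k) hu
  exact h1.unique h

lemma pd_congr (k : Fin 4) (f g : (Fin 4 → ℝ) → ℝ) (p : Fin 4 → ℝ) (h0 : 0 < p 0) (h2 : 0 < p 2)
    (h : ∀ q : Fin 4 → ℝ, 0 < q 0 → 0 < q 2 → f q = g q) : pd k f p = pd k g p := by
  unfold pd
  have : f =ᶠ[nhds p] g := by
    filter_upwards [dom_open p h0 h2] with q hq using h q hq.1 hq.2
  rw [this.fderiv_eq]

section
variable (β μ₁ μ₄ m : ℝ) (τ : ℝ → ℝ) (p : Fin 4 → ℝ) (h0 : 0 < p 0) (h2 : 0 < p 2)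
    (hτ : DifferentiableAt ℝ τ (bz β p))
include h0 h2 hτ

lemma pd0_bk : pd 0 (bk β μ₁ μ₄ m τ) p =
    bk β μ₁ μ₄ (m - 1) (fun ζ => m * τ ζ - β * ζ * deriv τ ζ) p := by
  apply pd_eq _ _ _ _ (bk_diff β μ₁ μ₄ m τ p h0 h2 hτ)
  simp only [bk, bz, Function.update_self, ne_eq, Fin.reduceEq, not_false_eq_true,
    Function.update_of_ne]
  have hm : HasDerivAt (fun s : ℝ => s ^ m) (m * p 0 ^ (m - 1)) (p 0) :=
    Real.hasDerivAt_rpow_const (Or.inl h0.ne')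
  have hb : HasDerivAt (fun s : ℝ => s ^ β) (β * p 0 ^ (β - 1)) (p 0) :=
    Real.hasDerivAt_rpow_const (Or.inl h0.ne')
  have hp : (p 0) ^ β ≠ 0 := by positivity
  have hz := (hasDerivAt_const (p 0) (Real.sqrt ((p 2) ^ 2 + (p 3) ^ 2))).fun_div hb hp
  have hc := HasDerivAt.comp (p 0) (h₂ := τ) hτ.hasDerivAt hz
  refine ((hm.mul_const _).fun_mul hc).congr_deriv ?_
  simp only [bz, Function.comp]
  rw [Real.rpow_sub_one h0.ne', Real.rpow_sub_one h0.ne']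
  have := h0.ne'
  field_simp
  ring

lemma pd1_bk : pd 1 (bk β μ₁ μ₄ m τ) p = μ₁ * bk β μ₁ μ₄ m τ p := by
  apply pd_eq _ _ _ _ (bk_diff β μ₁ μ₄ m τ p h0 h2 hτ)
  simp only [bk, bz, Function.update_self, ne_eq, Fin.reduceEq, not_false_eq_true,
    Function.update_of_ne]
  have he := ((((hasDerivAt_id (p 1)).const_mul μ₁).add_const
    (μ₄ * Real.arctan (p 3 / p 2))).exp.const_mul (p 0 ^ m)).mul_const
      (τ (Real.sqrt ((p 2) ^ 2 + (p 3) ^ 2) / (p 0) ^ β))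
  refine he.congr_deriv ?_
  simp only [id]
  ring

lemma bz_sq : (p 2) ^ 2 + (p 3) ^ 2 = (bz β p) ^ 2 * ((p 0) ^ β) ^ 2 := by
  unfold bz
  have hp : (p 0) ^ β ≠ 0 := by positivity
  rw [div_pow, Real.sq_sqrt (by positivity)]
  field_simp

lemma pd2_bk : pd 2 (bk β μ₁ μ₄ m τ) p =
    p 2 * bk β μ₁ μ₄ (m - 2 * β) (fun ζ => deriv τ ζ / ζ) p
     - p 3 * bk β μ₁ μ₄ (m - 2 * β) (fun ζ => μ₄ * τ ζ / ζ ^ 2) p := by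
  apply pd_eq _ _ _ _ (bk_diff β μ₁ μ₄ m τ p h0 h2 hτ)
  have hsq := bz_sq β τ p h0 h2 hτ
  have hzp := bz_pos β p h0 h2
  have hp : (p 0) ^ β ≠ 0 := by positivity
  have hr : (p 2) ^ 2 + (p 3) ^ 2 ≠ 0 := by positivity
  have hsr : Real.sqrt ((p 2) ^ 2 + (p 3) ^ 2) = bz β p * (p 0) ^ β := by
    unfold bz; field_simp
  have hz := ((((hasDerivAt_id (p 2)).fun_pow 2).add_const ((p 3) ^ 2)).sqrt hr).div_const ((p 0) ^ β)
  have hc := HasDerivAt.comp (p 2) (h₂ := τ) hτ.hasDerivAt hz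
  have ha := ((hasDerivAt_const (p 2) (p 3)).fun_div (hasDerivAt_id (p 2)) h2.ne').arctan
  have he := ((ha.const_mul μ₄).const_add (μ₁ * p 1)).exp.const_mul (p 0 ^ m)
  have key := he.fun_mul hc
  simp only [bk, Function.update_self, ne_eq, Fin.reduceEq, not_false_eq_true,
    Function.update_of_ne]
  simp only [bz, Function.update_self, ne_eq, Fin.reduceEq, not_false_eq_true,
    Function.update_of_ne]
  refine key.congr_deriv ?_
  simp only [Function.comp, id]
  rw [show Real.sqrt ((p 2) ^ 2 + (p 3) ^ 2) / p 0 ^ β = bz β p from rfl, hsr]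
  rw [Real.rpow_sub h0, mul_comm 2 β, Real.rpow_mul h0.le, Real.rpow_two]
  have h2' := h2.ne'
  have e : 1 + (p 3 / p 2) ^ 2 = (bz β p) ^ 2 * ((p 0) ^ β) ^ 2 / (p 2) ^ 2 := by
    rw [← hsq]; field_simp
  rw [e]
  field_simp
  push_cast
  ring

lemma pd3_bk : pd 3 (bk β μ₁ μ₄ m τ) p =
    p 3 * bk β μ₁ μ₄ (m - 2 * β) (fun ζ => deriv τ ζ / ζ) p
     + p 2 * bk β μ₁ μ₄ (m - 2 * β) (fun ζ => μ₄ * τ ζ / ζ ^ 2) p := by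
  apply pd_eq _ _ _ _ (bk_diff β μ₁ μ₄ m τ p h0 h2 hτ)
  have hsq := bz_sq β τ p h0 h2 hτ
  have hzp := bz_pos β p h0 h2
  have hp : (p 0) ^ β ≠ 0 := by positivity
  have hr : (p 2) ^ 2 + (p 3) ^ 2 ≠ 0 := by positivity
  have hsr : Real.sqrt ((p 2) ^ 2 + (p 3) ^ 2) = bz β p * (p 0) ^ β := by
    unfold bz; field_simp
  have hz := ((((hasDerivAt_id (p 3)).fun_pow 2).const_add ((p 2) ^ 2)).sqrt hr).div_const ((p 0) ^ β)
  have hc := HasDerivAt.comp (p 3) (h₂ := τ) hτ.hasDerivAt hz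
  have ha := ((hasDerivAt_id (p 3)).div_const (p 2)).arctan
  have he := ((ha.const_mul μ₄).const_add (μ₁ * p 1)).exp.const_mul (p 0 ^ m)
  have key := he.fun_mul hc
  simp only [bk, Function.update_self, ne_eq, Fin.reduceEq, not_false_eq_true,
    Function.update_of_ne]
  simp only [bz, Function.update_self, ne_eq, Fin.reduceEq, not_false_eq_true,
    Function.update_of_ne]
  refine key.congr_deriv ?_
  simp only [Function.comp, id]
  rw [show Real.sqrt ((p 2) ^ 2 + (p 3) ^ 2) / p 0 ^ β = bz β p from rfl, hsr]
  rw [Real.rpow_sub h0, mul_comm 2 β, Real.rpow_mul h0.le, Real.rpow_two]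
  have h2' := h2.ne'
  have e : 1 + (p 3 / p 2) ^ 2 = (bz β p) ^ 2 * ((p 0) ^ β) ^ 2 / (p 2) ^ 2 := by
    rw [← hsq]; field_simp
  rw [e]
  field_simp
  push_cast
  ring
end

lemma pd_comb (k i j : Fin 4) (c : ℝ) (f g : (Fin 4 → ℝ) → ℝ) (p : Fin 4 → ℝ)
    (hf : DifferentiableAt ℝ f p) (hg : DifferentiableAt ℝ g p) :
    pd k (fun q => q i * f q + c * (q j * g q)) p =
      (Pi.single k 1 : Fin 4 → ℝ) i * f p + p i * pd k f p
      + c * ((Pi.single k 1 : Fin 4 → ℝ) j * g p + p j * pd k g p) := by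
  unfold pd
  have h := ((hasFDerivAt_apply (𝕜 := ℝ) i p).fun_mul hf.hasFDerivAt).fun_add
    (((hasFDerivAt_apply (𝕜 := ℝ) j p).fun_mul hg.hasFDerivAt).const_mul c)
  rw [h.fderiv]
  simp
  ring

lemma pde_eq (β μ₁ μ₄ μ₅ : ℝ) (W : ℝ → ℝ)
    (σ : ℝ → ℝ) (hσ : ∀ x, 0 < x → DifferentiableAt ℝ σ x)
    (hσ' : ∀ x, 0 < x → DifferentiableAt ℝ (deriv σ) x)
    (u : (Fin 4 → ℝ) → ℝ) (hu : u = bk β μ₁ μ₄ μ₅ σ)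
    (p : Fin 4 → ℝ) (h0 : 0 < p 0) (h2 : 0 < p 2) :
    -(pd 0 (pd 0 u) p) + ((p 0) ^ 2)⁻¹ * pd 1 (pd 1 u) p
        + (p 0) ^ (2 * β - 2) * (pd 2 (pd 2 u) p + pd 3 (pd 3 u) p)
        - (3 - 2 * β) / p 0 * pd 0 u p
        + ((p 0) ^ 2)⁻¹ * W (((p 2) ^ 2 + (p 3) ^ 2) / (p 0) ^ (2 * β)) * u p =
    bk β μ₁ μ₄ (μ₅ - 2) (fun ζ => (1 - β ^ 2 * ζ ^ 2) * deriv (deriv σ) ζ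
        + (1 / ζ + β * ζ * (2 + 2 * μ₅ - 3 * β)) * deriv σ ζ
        + (μ₅ * (2 * β - 2 - μ₅) + μ₁ ^ 2 + μ₄ ^ 2 / ζ ^ 2 + W (ζ ^ 2)) * σ ζ) p := by
  subst hu
  have zp := bz_pos β p h0 h2
  have dσ := hσ _ zp
  have dσ' := hσ' _ zp
  have hS := dσ.hasDerivAt
  have hS' := dσ'.hasDerivAt
  have hI := hasDerivAt_id (bz β p)
  have hsq := bz_sq β σ p h0 h2 dσ
  -- time
  have hτ1 : HasDerivAt (fun ζ => μ₅ * σ ζ - β * ζ * deriv σ ζ)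
      (μ₅ * deriv σ (bz β p) - (β * deriv σ (bz β p) + β * bz β p * deriv (deriv σ) (bz β p)))
      (bz β p) := by
    refine ((hS.const_mul μ₅).fun_sub ((hI.const_mul β).fun_mul hS')).congr_deriv ?_
    simp
  have hα : HasDerivAt (fun ζ => deriv σ ζ / ζ)
      (deriv (deriv σ) (bz β p) / bz β p - deriv σ (bz β p) / bz β p ^ 2) (bz β p) := by
    refine (hS'.fun_div hI zp.ne').congr_deriv ?_
    simp only [id]
    field_simp
  have hγ : HasDerivAt (fun ζ => μ₄ * σ ζ / ζ ^ 2)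
      (μ₄ * deriv σ (bz β p) / bz β p ^ 2 - 2 * μ₄ * σ (bz β p) / bz β p ^ 3) (bz β p) := by
    refine ((hS.const_mul μ₄).fun_div (hI.fun_pow 2) (by simp [zp.ne'])).congr_deriv ?_
    simp only [id]
    field_simp
    push_cast
    ring
  have e0 : pd 0 (pd 0 (bk β μ₁ μ₄ μ₅ σ)) p = _ :=
    (pd_congr 0 _ _ p h0 h2 (fun q q0 q2 =>
      pd0_bk β μ₁ μ₄ μ₅ σ q q0 q2 (hσ _ (bz_pos β q q0 q2)))).trans
    (pd0_bk β μ₁ μ₄ (μ₅ - 1) _ p h0 h2 hτ1.differentiableAt)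
  have e1 : pd 1 (pd 1 (bk β μ₁ μ₄ μ₅ σ)) p = μ₁ * (μ₁ * bk β μ₁ μ₄ μ₅ σ p) := by
    rw [pd_congr 1 _ (fun q => μ₁ * bk β μ₁ μ₄ μ₅ σ q) p h0 h2 (fun q q0 q2 =>
      pd1_bk β μ₁ μ₄ μ₅ σ q q0 q2 (hσ _ (bz_pos β q q0 q2)))]
    rw [← pd1_bk β μ₁ μ₄ μ₅ σ p h0 h2 dσ]
    unfold pd
    rw [fderiv_const_mul (bk_diff β μ₁ μ₄ μ₅ σ p h0 h2 dσ)]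
    rfl
  have dA := bk_diff β μ₁ μ₄ (μ₅ - 2 * β) _ p h0 h2 hα.differentiableAt
  have dG := bk_diff β μ₁ μ₄ (μ₅ - 2 * β) _ p h0 h2 hγ.differentiableAt
  have e2 := (pd_congr 2 _ _ p h0 h2 (fun q q0 q2 =>
      (pd2_bk β μ₁ μ₄ μ₅ σ q q0 q2 (hσ _ (bz_pos β q q0 q2))).trans
      (by rw [sub_eq_add_neg, neg_eq_neg_one_mul]))).trans (pd_comb 2 2 3 (-1) _ _ p dA dG)
  have e3 := (pd_congr 3 _ _ p h0 h2 (fun q q0 q2 =>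
      (pd3_bk β μ₁ μ₄ μ₅ σ q q0 q2 (hσ _ (bz_pos β q q0 q2))).trans
      (by rw [one_mul]))).trans (pd_comb 3 3 2 1 _ _ p dA dG)
  rw [pd2_bk β μ₁ μ₄ _ _ p h0 h2 hα.differentiableAt,
    pd2_bk β μ₁ μ₄ _ _ p h0 h2 hγ.differentiableAt] at e2
  rw [pd3_bk β μ₁ μ₄ _ _ p h0 h2 hα.differentiableAt,
    pd3_bk β μ₁ μ₄ _ _ p h0 h2 hγ.differentiableAt] at e3
  rw [e0, e1, e2, e3, pd0_bk β μ₁ μ₄ μ₅ σ p h0 h2 dσ]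
  have hw : ((p 2) ^ 2 + (p 3) ^ 2) / (p 0) ^ (2 * β) = bz β p ^ 2 := by
    rw [hsq, mul_comm 2 β, Real.rpow_mul h0.le, Real.rpow_two]
    have hp : (p 0) ^ β ≠ 0 := by positivity
    field_simp
  rw [hw]
  unfold bk
  simp only [hτ1.deriv, hα.deriv, hγ.deriv]
  have r1 : p 0 ^ (μ₅ - 1 - 1) = p 0 ^ μ₅ / p 0 ^ 2 := by
    rw [Real.rpow_sub_one h0.ne', Real.rpow_sub_one h0.ne']; field_simp
  have r2 : p 0 ^ (μ₅ - 2) = p 0 ^ μ₅ / p 0 ^ 2 := by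
    rw [Real.rpow_sub h0, Real.rpow_two]
  have r3 : p 0 ^ (2 * β - 2) = (p 0 ^ β) ^ 2 / p 0 ^ 2 := by
    rw [Real.rpow_sub h0, Real.rpow_two, mul_comm 2 β, Real.rpow_mul h0.le, Real.rpow_two]
  have r4 : p 0 ^ (μ₅ - 2 * β) = p 0 ^ μ₅ / (p 0 ^ β) ^ 2 := by
    rw [Real.rpow_sub h0, mul_comm 2 β, Real.rpow_mul h0.le, Real.rpow_two]
  have r5 : p 0 ^ (μ₅ - 2 * β - 2 * β) = p 0 ^ μ₅ / (p 0 ^ β) ^ 4 := by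
    rw [Real.rpow_sub h0, r4, mul_comm 2 β, Real.rpow_mul h0.le, Real.rpow_two]
    field_simp
  rw [r1, r2, r3, r4, r5, Real.rpow_sub_one h0.ne']
  have hb : 0 < p 0 ^ β := by positivity
  have h3 : (p 3) ^ 2 = (bz β p) ^ 2 * ((p 0) ^ β) ^ 2 - (p 2) ^ 2 := by linarith
  simp only [Pi.single_eq_same, ne_eq, Fin.reduceEq, not_false_eq_true, Pi.single_eq_of_ne]
  generalize Real.exp _ = E
  generalize p 0 ^ μ₅ = M
  generalize p 0 ^ β = b at *
  generalize W _ = w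
  generalize bz β p = z at *
  generalize deriv (deriv σ) z = s2
  generalize deriv σ z = s1
  generalize σ z = s
  generalize p 0 = t at *
  generalize p 2 = y at *
  generalize p 3 = x at *
  field_simp
  ring_nf
  try simp only [h3]
  try ring_nf


/-- in the Bianchi I spacetime `g = diag(−1, t², t^{2−2β}, t^{2−2β})`, the
invariant ansatz `u = t^{μ₅} e^{μ₁x + μ₄ arctan(z/y)} σ(√(y²+z²)/t^β)` solves the Klein–Gordon
equation with potential `t^{−2} W((y²+z²)/t^{2β})` on `{t > 0, y > 0}` iff `σ` solves the
reduced ODE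
`(1−β²ζ²)σ″ + (1/ζ + βζ(2+2μ₅−3β))σ′ + (μ₅(2β−2−μ₅) + μ₁² + μ₄²/ζ² + W(ζ²))σ = 0` on `ζ > 0`. -/
theorem stmt15 (β μ₁ μ₄ μ₅ : ℝ) (W : ℝ → ℝ) (hW : ContDiff ℝ (⊤ : ℕ∞) W)
    (σ : ℝ → ℝ) (hσ : ContDiffOn ℝ (⊤ : ℕ∞) σ (Set.Ioi 0))
    (u : (Fin 4 → ℝ) → ℝ)
    (hu : ∀ p : Fin 4 → ℝ,
      u p = (p 0) ^ μ₅ * Real.exp (μ₁ * p 1 + μ₄ * Real.arctan (p 3 / p 2)) *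
        σ (Real.sqrt ((p 2) ^ 2 + (p 3) ^ 2) / (p 0) ^ β)) :
    (∀ p : Fin 4 → ℝ, 0 < p 0 → 0 < p 2 →
      -(pd 0 (pd 0 u) p) + ((p 0) ^ 2)⁻¹ * pd 1 (pd 1 u) p
        + (p 0) ^ (2 * β - 2) * (pd 2 (pd 2 u) p + pd 3 (pd 3 u) p)
        - (3 - 2 * β) / p 0 * pd 0 u p
        + ((p 0) ^ 2)⁻¹ * W (((p 2) ^ 2 + (p 3) ^ 2) / (p 0) ^ (2 * β)) * u p = 0)
    ↔ (∀ ζ : ℝ, 0 < ζ →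
      (1 - β ^ 2 * ζ ^ 2) * deriv (deriv σ) ζ
        + (1 / ζ + β * ζ * (2 + 2 * μ₅ - 3 * β)) * deriv σ ζ
        + (μ₅ * (2 * β - 2 - μ₅) + μ₁ ^ 2 + μ₄ ^ 2 / ζ ^ 2 + W (ζ ^ 2)) * σ ζ = 0) := by
  have hu' : u = bk β μ₁ μ₄ μ₅ σ := funext hu
  have d1 : ∀ x, 0 < x → DifferentiableAt ℝ σ x := fun x hx =>
    (hσ.contDiffAt (Ioi_mem_nhds hx)).differentiableAt (by simp)
  have hσ2 : ContDiffOn ℝ 1 (deriv σ) (Set.Ioi 0) :=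
    hσ.deriv_of_isOpen isOpen_Ioi (by first | exact WithTop.coe_le_coe.mpr (le_top : (1 + 1 : ℕ∞) ≤ ⊤) | simp)
  have d2 : ∀ x, 0 < x → DifferentiableAt ℝ (deriv σ) x := fun x hx =>
    (hσ2.contDiffAt (Ioi_mem_nhds hx)).differentiableAt (by simp)
  have key := pde_eq β μ₁ μ₄ μ₅ W σ d1 d2 u hu'
  constructor
  · intro h ζ hζ
    have hp := h ![1, 0, ζ, 0] (by simp) (by simpa using hζ)
    rw [key _ (by simp) (by simpa using hζ)] at hp
    have hz : bz β ![1, 0, ζ, 0] = ζ := by simp [bz, Real.sqrt_sq hζ.le]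
    rw [bk, hz] at hp
    simpa using hp
  · intro h p h0 h2
    rw [key p h0 h2, bk, h _ (bz_pos β p h0 h2), mul_zero]
end

section
/- Let μ₃, μ₄, μ₅ ∈ ℝ, let F : ℝ → ℝ and σ : ℝ → ℝ be smooth, and on the region 0 < t < π/2 of ℝ⁴ define u(t,x,y,z) = σ(x + ln(sin t)) · exp( μ₃ z − (cot t / 2)(μ₄ e^{−(x+y)} + μ₅ e^{−x+y}) ). Then u satisfies the Klein–Gordon equation −u_{tt} + sin^{−2}t · u_{xx} + cos^{−2}t · u_{yy} + u_{zz} + (tan t − cot t) u_t + F(x + ln(sin t)) u = 0 on this region if and only if σ satisfies, for all ζ ∈ ℝ, the reduced ordinary differential equation σ″(ζ) + 2 σ′(ζ) + (F(ζ) + μ₃² − μ₄ μ₅ e^{−2ζ}) σ(ζ) = 0. -/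
open Real

lemma pd_of (k : Fin 4) (f g : (Fin 4 → ℝ) → ℝ) (p : Fin 4 → ℝ) (v : ℝ)
    (hfg : f =ᶠ[nhds p] g) (hg : DifferentiableAt ℝ g p)
    (h : HasDerivAt (fun r => g (Function.update p k r)) v (p k)) : pd k f p = v := by
  unfold pd
  rw [hfg.fderiv_eq]
  have h1 : HasDerivAt (fun r => Function.update p k r) (Pi.single k (1:ℝ)) (p k) :=
    hasDerivAt_update p k (p k)
  have h2 : HasFDerivAt g (fderiv ℝ g p) (Function.update p k (p k)) := by
    rw [Function.update_eq_self]; exact hg.hasFDerivAt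
  exact (h2.comp_hasDerivAt (p k) h1).unique h

lemma expT (m S r : ℝ) (hs : sin r ≠ 0) :
    HasDerivAt (fun r => exp (m - cos r / sin r / 2 * S))
      (exp (m - cos r / sin r / 2 * S) * (S / (2 * sin r ^ 2))) r := by
  have h := (((((hasDerivAt_cos r).div (hasDerivAt_sin r) hs).div_const 2).mul_const S).const_sub m).exp
  refine h.congr_deriv ?_
  simp only [Pi.div_apply]
  congr 1
  field_simp
  linear_combination S * sin_sq_add_cos_sq r

lemma sigT (f : ℝ → ℝ) (hf : Differentiable ℝ f) (x r : ℝ) (hs : sin r ≠ 0) :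
    HasDerivAt (fun r => f (x + log (sin r))) (deriv f (x + log (sin r)) * (cos r / sin r)) r :=
  (hf _).hasDerivAt.comp r (((hasDerivAt_sin r).log hs).const_add x)

lemma sig1 (f : ℝ → ℝ) (hf : Differentiable ℝ f) (c r : ℝ) :
    HasDerivAt (fun r => f (r + c)) (deriv f (r + c)) r := by
  exact ((hf (r + c)).hasDerivAt.comp r ((hasDerivAt_id r).add_const c)).congr_deriv (mul_one _)

lemma SX (a b y r : ℝ) : HasDerivAt (fun r => a * exp (-(r + y)) + b * exp (-r + y))
    (-(a * exp (-(r + y)) + b * exp (-r + y))) r := by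
  have h := ((((hasDerivAt_id r).add_const y).neg.exp).const_mul a).add
    ((((hasDerivAt_id r).neg.add_const y).exp).const_mul b)
  refine h.congr_deriv ?_
  simp; ring

lemma SY (a b x r : ℝ) : HasDerivAt (fun r => a * exp (-(x + r)) + b * exp (-x + r))
    (-a * exp (-(x + r)) + b * exp (-x + r)) r := by
  have h := ((((hasDerivAt_id r).const_add x).neg.exp).const_mul a).add
    ((((hasDerivAt_id r).const_add (-x)).exp).const_mul b)
  refine h.congr_deriv ?_
  simp

lemma sin_ev (p : Fin 4 → ℝ) (h : sin (p 0) ≠ 0) : ∀ᶠ q in nhds p, sin (q 0) ≠ 0 := by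
  have : ContinuousAt (fun q : Fin 4 → ℝ => sin (q 0)) p :=
    (continuous_sin.comp (continuous_apply 0)).continuousAt
  exact this.eventually_ne h

/-- in the conformally flat Bianchi I spacetime `g = diag(−1, sin²t, cos²t, 1)`,
the invariant ansatz `u = σ(x + ln sin t) exp(μ₃z − (cot t/2)(μ₄e^{−(x+y)} + μ₅e^{−x+y}))`
solves the Klein–Gordon equation with potential `F(x + ln sin t)` on `0 < t < π/2` iff `σ`
solves `σ″ + 2σ′ + (F(ζ) + μ₃² − μ₄μ₅e^{−2ζ})σ = 0`. -/
theorem stmt16 (μ₃ μ₄ μ₅ : ℝ) (F σ : ℝ → ℝ)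
    (hF : ContDiff ℝ (⊤ : ℕ∞) F) (hσ : ContDiff ℝ (⊤ : ℕ∞) σ)
    (u : (Fin 4 → ℝ) → ℝ)
    (hu : ∀ p : Fin 4 → ℝ,
      u p = σ (p 1 + Real.log (Real.sin (p 0))) *
        Real.exp (μ₃ * p 3 - Real.cot (p 0) / 2 *
          (μ₄ * Real.exp (-(p 1 + p 2)) + μ₅ * Real.exp (-(p 1) + p 2)))) :
    (∀ p : Fin 4 → ℝ, p 0 ∈ Set.Ioo 0 (π / 2) →
      -(pd 0 (pd 0 u) p) + (Real.sin (p 0) ^ 2)⁻¹ * pd 1 (pd 1 u) p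
        + (Real.cos (p 0) ^ 2)⁻¹ * pd 2 (pd 2 u) p + pd 3 (pd 3 u) p
        + (Real.tan (p 0) - Real.cot (p 0)) * pd 0 u p
        + F (p 1 + Real.log (Real.sin (p 0))) * u p = 0)
    ↔ (∀ ζ : ℝ,
      deriv (deriv σ) ζ + 2 * deriv σ ζ
        + (F ζ + μ₃ ^ 2 - μ₄ * μ₅ * Real.exp (-(2 * ζ))) * σ ζ = 0) := by
  have hd : Differentiable ℝ σ := hσ.differentiable (by simp)
  have hσ' : ContDiff ℝ 1 (deriv σ) := by
    have h2 : ContDiff ℝ 2 σ := contDiff_infty.1 hσ 2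
    exact ((contDiff_succ_iff_deriv (n := 1)).1 h2).2.2
  have hd' : Differentiable ℝ (deriv σ) := hσ'.differentiable (by simp)
  have hu' : u = fun p => σ (p 1 + log (sin (p 0))) *
        exp (μ₃ * p 3 - cos (p 0) / sin (p 0) / 2 *
          (μ₄ * exp (-(p 1 + p 2)) + μ₅ * exp (-(p 1) + p 2))) := by
    funext p; rw [hu, Real.cot_eq_cos_div_sin]
  clear hu
  have e01 : (1 : Fin 4) ≠ 0 := by decide
  have e02 : (2 : Fin 4) ≠ 0 := by decide
  have e03 : (3 : Fin 4) ≠ 0 := by decide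
  -- first derivatives
  have t1 : ∀ p : Fin 4 → ℝ, sin (p 0) ≠ 0 → pd 0 u p =
      (deriv σ (p 1 + log (sin (p 0))) * (cos (p 0) / sin (p 0)) + σ (p 1 + log (sin (p 0))) *
        ((μ₄ * exp (-(p 1 + p 2)) + μ₅ * exp (-(p 1) + p 2)) / (2 * sin (p 0) ^ 2))) *
      exp (μ₃ * p 3 - cos (p 0) / sin (p 0) / 2 *
          (μ₄ * exp (-(p 1 + p 2)) + μ₅ * exp (-(p 1) + p 2))) := by
    intro p hp
    refine pd_of 0 u _ p _ (Filter.EventuallyEq.of_eq hu') (by fun_prop (disch := assumption)) ?_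
    simp
    refine ((sigT σ hd (p 1) (p 0) hp).mul (expT (μ₃ * p 3) _ (p 0) hp)).congr_deriv ?_
    ring
  have x1 : ∀ p : Fin 4 → ℝ, sin (p 0) ≠ 0 → pd 1 u p =
      (deriv σ (p 1 + log (sin (p 0))) + σ (p 1 + log (sin (p 0))) *
        (cos (p 0) / sin (p 0) / 2 * (μ₄ * exp (-(p 1 + p 2)) + μ₅ * exp (-(p 1) + p 2)))) *
      exp (μ₃ * p 3 - cos (p 0) / sin (p 0) / 2 *
          (μ₄ * exp (-(p 1 + p 2)) + μ₅ * exp (-(p 1) + p 2))) := by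
    intro p hp
    refine pd_of 1 u _ p _ (Filter.EventuallyEq.of_eq hu') (by fun_prop (disch := assumption)) ?_
    simp [-neg_add_rev]
    refine ((sig1 σ hd (log (sin (p 0))) (p 1)).mul (((SX μ₄ μ₅ (p 2) (p 1)).const_mul
      (cos (p 0) / sin (p 0) / 2)).const_sub (μ₃ * p 3)).exp).congr_deriv ?_
    ring
  have y1 : ∀ p : Fin 4 → ℝ, sin (p 0) ≠ 0 → pd 2 u p =
      (σ (p 1 + log (sin (p 0))) *
        (-(cos (p 0) / sin (p 0) / 2) * (-μ₄ * exp (-(p 1 + p 2)) + μ₅ * exp (-(p 1) + p 2)))) *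
      exp (μ₃ * p 3 - cos (p 0) / sin (p 0) / 2 *
          (μ₄ * exp (-(p 1 + p 2)) + μ₅ * exp (-(p 1) + p 2))) := by
    intro p hp
    refine pd_of 2 u _ p _ (Filter.EventuallyEq.of_eq hu') (by fun_prop (disch := assumption)) ?_
    simp [-neg_add_rev]
    refine ((((SY μ₄ μ₅ (p 1) (p 2)).const_mul
      (cos (p 0) / sin (p 0) / 2)).const_sub (μ₃ * p 3)).exp.const_mul
      (σ (p 1 + log (sin (p 0))))).congr_deriv ?_
    ring
  have z1 : ∀ p : Fin 4 → ℝ, sin (p 0) ≠ 0 → pd 3 u p =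
      (σ (p 1 + log (sin (p 0))) * μ₃) *
      exp (μ₃ * p 3 - cos (p 0) / sin (p 0) / 2 *
          (μ₄ * exp (-(p 1 + p 2)) + μ₅ * exp (-(p 1) + p 2))) := by
    intro p hp
    refine pd_of 3 u _ p _ (Filter.EventuallyEq.of_eq hu') (by fun_prop (disch := assumption)) ?_
    simp
    refine (((((hasDerivAt_id (p 3)).const_mul μ₃).sub_const _).exp).const_mul
      (σ (p 1 + log (sin (p 0))))).congr_deriv ?_
    simp; ring
  -- second derivatives
  have t2 : ∀ p : Fin 4 → ℝ, sin (p 0) ≠ 0 → pd 0 (pd 0 u) p =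
      (deriv (deriv σ) (p 1 + log (sin (p 0))) * (cos (p 0) / sin (p 0)) ^ 2
        + 2 * deriv σ (p 1 + log (sin (p 0))) * (cos (p 0) / sin (p 0)) *
          ((μ₄ * exp (-(p 1 + p 2)) + μ₅ * exp (-(p 1) + p 2)) / (2 * sin (p 0) ^ 2))
        - deriv σ (p 1 + log (sin (p 0))) / sin (p 0) ^ 2
        + σ (p 1 + log (sin (p 0))) *
        (((μ₄ * exp (-(p 1 + p 2)) + μ₅ * exp (-(p 1) + p 2)) / (2 * sin (p 0) ^ 2)) ^ 2
          - (μ₄ * exp (-(p 1 + p 2)) + μ₅ * exp (-(p 1) + p 2)) * cos (p 0) / sin (p 0) ^ 3)) *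
      exp (μ₃ * p 3 - cos (p 0) / sin (p 0) / 2 *
          (μ₄ * exp (-(p 1 + p 2)) + μ₅ * exp (-(p 1) + p 2))) := by
    intro p hp
    have hp2 : 2 * sin (p 0) ^ 2 ≠ 0 := by positivity
    refine pd_of 0 _ _ p _ ((sin_ev p hp).mono fun q hq => t1 q hq)
      (by fun_prop (disch := assumption)) ?_
    simp
    have hc : HasDerivAt (fun r => cos r / sin r) (-1 / sin (p 0) ^ 2) (p 0) := by
      refine ((hasDerivAt_cos (p 0)).div (hasDerivAt_sin (p 0)) hp).congr_deriv ?_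
      congr 1
      linear_combination - sin_sq_add_cos_sq (p 0)
    have hq : HasDerivAt (fun r => (μ₄ * exp (-p 2 + -p 1) + μ₅ * exp (-(p 1) + p 2)) / (2 * sin r ^ 2))
        (-((μ₄ * exp (-p 2 + -p 1) + μ₅ * exp (-(p 1) + p 2)) * cos (p 0) / sin (p 0) ^ 3)) (p 0) := by
      refine ((hasDerivAt_const (p 0) _).div (((hasDerivAt_sin (p 0)).pow 2).const_mul 2)
        hp2).congr_deriv ?_
      simp
      field_simp
    have hm := (((sigT (deriv σ) hd' (p 1) (p 0) hp).mul hc).add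
      ((sigT σ hd (p 1) (p 0) hp).mul hq)).mul (expT (μ₃ * p 3)
        (μ₄ * exp (-p 2 + -p 1) + μ₅ * exp (-(p 1) + p 2)) (p 0) hp)
    refine hm.congr_deriv ?_
    have hE : exp (-(p 1 + p 2)) = exp (-p 2 + -p 1) := by congr 1; ring
    simp
    ring
  have x2 : ∀ p : Fin 4 → ℝ, sin (p 0) ≠ 0 → pd 1 (pd 1 u) p =
      (deriv (deriv σ) (p 1 + log (sin (p 0))) + 2 * deriv σ (p 1 + log (sin (p 0))) *
        (cos (p 0) / sin (p 0) / 2 * (μ₄ * exp (-(p 1 + p 2)) + μ₅ * exp (-(p 1) + p 2)))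
       + σ (p 1 + log (sin (p 0))) *
        ((cos (p 0) / sin (p 0) / 2 * (μ₄ * exp (-(p 1 + p 2)) + μ₅ * exp (-(p 1) + p 2))) ^ 2
        - cos (p 0) / sin (p 0) / 2 * (μ₄ * exp (-(p 1 + p 2)) + μ₅ * exp (-(p 1) + p 2)))) *
      exp (μ₃ * p 3 - cos (p 0) / sin (p 0) / 2 *
          (μ₄ * exp (-(p 1 + p 2)) + μ₅ * exp (-(p 1) + p 2))) := by
    intro p hp
    refine pd_of 1 _ _ p _ ((sin_ev p hp).mono fun q hq => x1 q hq)
      (by fun_prop (disch := assumption)) ?_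
    simp [-neg_add_rev]
    have hS := (SX μ₄ μ₅ (p 2) (p 1)).const_mul (cos (p 0) / sin (p 0) / 2)
    refine (((sig1 (deriv σ) hd' (log (sin (p 0))) (p 1)).add
      ((sig1 σ hd (log (sin (p 0))) (p 1)).mul hS)).mul
      (hS.const_sub (μ₃ * p 3)).exp).congr_deriv ?_
    simp [-neg_add_rev]
    ring
  have y2 : ∀ p : Fin 4 → ℝ, sin (p 0) ≠ 0 → pd 2 (pd 2 u) p =
      (σ (p 1 + log (sin (p 0))) *
        ((cos (p 0) / sin (p 0) / 2 * (-μ₄ * exp (-(p 1 + p 2)) + μ₅ * exp (-(p 1) + p 2))) ^ 2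
        - cos (p 0) / sin (p 0) / 2 * (μ₄ * exp (-(p 1 + p 2)) + μ₅ * exp (-(p 1) + p 2)))) *
      exp (μ₃ * p 3 - cos (p 0) / sin (p 0) / 2 *
          (μ₄ * exp (-(p 1 + p 2)) + μ₅ * exp (-(p 1) + p 2))) := by
    intro p hp
    refine pd_of 2 _ _ p _ ((sin_ev p hp).mono fun q hq => y1 q hq)
      (by fun_prop (disch := assumption)) ?_
    simp [-neg_add_rev, -neg_mul, -mul_neg]
    have hS := (SY μ₄ μ₅ (p 1) (p 2)).const_mul (cos (p 0) / sin (p 0) / 2)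
    have hD := (SY (-μ₄) μ₅ (p 1) (p 2)).const_mul (-(cos (p 0) / sin (p 0) / 2))
    refine ((hD.const_mul (σ (p 1 + log (sin (p 0))))).mul
      (hS.const_sub (μ₃ * p 3)).exp).congr_deriv ?_
    ring
  have z2 : ∀ p : Fin 4 → ℝ, sin (p 0) ≠ 0 → pd 3 (pd 3 u) p =
      (σ (p 1 + log (sin (p 0))) * μ₃ ^ 2) *
      exp (μ₃ * p 3 - cos (p 0) / sin (p 0) / 2 *
          (μ₄ * exp (-(p 1 + p 2)) + μ₅ * exp (-(p 1) + p 2))) := by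
    intro p hp
    refine pd_of 3 _ _ p _ ((sin_ev p hp).mono fun q hq => z1 q hq)
      (by fun_prop (disch := assumption)) ?_
    simp
    refine (((((hasDerivAt_id (p 3)).const_mul μ₃).sub_const _).exp).const_mul
      (σ (p 1 + log (sin (p 0))) * μ₃)).congr_deriv ?_
    simp; ring
  -- the operator
  have key : ∀ p : Fin 4 → ℝ, p 0 ∈ Set.Ioo 0 (π / 2) →
      -(pd 0 (pd 0 u) p) + (Real.sin (p 0) ^ 2)⁻¹ * pd 1 (pd 1 u) p
        + (Real.cos (p 0) ^ 2)⁻¹ * pd 2 (pd 2 u) p + pd 3 (pd 3 u) p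
        + (Real.tan (p 0) - Real.cot (p 0)) * pd 0 u p
        + F (p 1 + Real.log (Real.sin (p 0))) * u p =
      (deriv (deriv σ) (p 1 + log (sin (p 0))) + 2 * deriv σ (p 1 + log (sin (p 0)))
        + (F (p 1 + log (sin (p 0))) + μ₃ ^ 2
          - μ₄ * μ₅ * exp (-(2 * (p 1 + log (sin (p 0)))))) * σ (p 1 + log (sin (p 0)))) *
      exp (μ₃ * p 3 - cos (p 0) / sin (p 0) / 2 *
          (μ₄ * exp (-(p 1 + p 2)) + μ₅ * exp (-(p 1) + p 2))) := by
    intro p hp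
    have hs : 0 < sin (p 0) := sin_pos_of_pos_of_lt_pi hp.1 (by linarith [hp.2, pi_pos])
    have hc : 0 < cos (p 0) := cos_pos_of_mem_Ioo ⟨by linarith [hp.1, pi_pos], hp.2⟩
    have hs0 := hs.ne'
    have hc0 := hc.ne'
    rw [t2 p hs0, x2 p hs0, y2 p hs0, z2 p hs0, t1 p hs0, hu', Real.cot_eq_cos_div_sin,
      Real.tan_eq_sin_div_cos]
    have hE : exp (-(2 * (p 1 + log (sin (p 0))))) =
        exp (-(p 1 + p 2)) * exp (-(p 1) + p 2) / sin (p 0) ^ 2 := by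
      rw [← exp_add, eq_div_iff (by positivity)]
      nth_rewrite 2 [← exp_log hs]
      rw [← exp_nat_mul, ← exp_add]
      congr 1; push_cast; ring
    rw [hE]
    have hsc := sin_sq_add_cos_sq (p 0)
    beta_reduce
    generalize exp (μ₃ * p 3 - cos (p 0) / sin (p 0) / 2 *
          (μ₄ * exp (-(p 1 + p 2)) + μ₅ * exp (-(p 1) + p 2))) = E
    generalize exp (-(p 1 + p 2)) = A at *
    generalize exp (-(p 1) + p 2) = B at *
    generalize deriv (deriv σ) (p 1 + log (sin (p 0))) = s2
    generalize deriv σ (p 1 + log (sin (p 0))) = s1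
    generalize σ (p 1 + log (sin (p 0))) = s0
    generalize F (p 1 + log (sin (p 0))) = f
    generalize sin (p 0) = s at *
    generalize cos (p 0) = c at *
    have hc2 : c ^ 2 = 1 - s ^ 2 := by linarith
    have q2 : -(c / s) ^ 2 + (s ^ 2)⁻¹ = 1 := by
      field_simp; linarith
    have q1 : 1 / s ^ 2 + (s / c - c / s) * (c / s) = 2 := by
      field_simp; linarith
    have q3 : c / s ^ 3 - (s ^ 2)⁻¹ * (c / s / 2) - (c ^ 2)⁻¹ * (c / s / 2)
        + (s / c - c / s) * (1 / (2 * s ^ 2)) = 0 := by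
      field_simp; ring
    have q4 : -(1 / (2 * s ^ 2)) ^ 2 + (s ^ 2)⁻¹ * (c / s / 2) ^ 2 = - (1 / (4 * s ^ 2)) := by
      field_simp; linarith
    have q5 : (c ^ 2)⁻¹ * (c / s / 2) ^ 2 = 1 / (4 * s ^ 2) := by
      field_simp; norm_num
    linear_combination (s2 * q2 + s1 * q1 + s0 * (μ₄ * A + μ₅ * B) * q3
      + s0 * (μ₄ * A + μ₅ * B) ^ 2 * q4 + s0 * (-μ₄ * A + μ₅ * B) ^ 2 * q5) * E
  constructor
  · intro h ζ
    have hp : (![π / 4, ζ - log (sin (π / 4)), 0, 0] : Fin 4 → ℝ) 0 ∈ Set.Ioo 0 (π / 2) := by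
      simp; constructor <;> linarith [pi_pos]
    have h1 := h _ hp
    rw [key _ hp] at h1
    have h2 := (mul_eq_zero.1 h1).resolve_right (exp_ne_zero _)
    have h3 : (![π / 4, ζ - log (sin (π / 4)), 0, 0] : Fin 4 → ℝ) 1
        + log (sin ((![π / 4, ζ - log (sin (π / 4)), 0, 0] : Fin 4 → ℝ) 0)) = ζ := by
      show ζ - log (sin (π / 4)) + log (sin (π / 4)) = ζ
      ring
    rw [h3] at h2
    exact h2
  · intro h p hp
    rw [key p hp, h, zero_mul]
end

section
/- Let μ₃, μ₄, μ₅, σ₁, σ₂ ∈ ℝ with μ₃² ≤ 1, and set λ± = −1 ± √(1 − μ₃²). On the region 0 < t < π/2 of ℝ⁴ define ζ = x + ln(sin t) and u(t,x,y,z) = ( σ₁ e^{λ₊ ζ} + σ₂ e^{λ₋ ζ} ) · exp( μ₃ z − (cot t / 2)(μ₄ e^{−(x+y)} + μ₅ e^{−x+y}) ). Then u satisfies the Klein–Gordon equation −u_{tt} + sin^{−2}t · u_{xx} + cos^{−2}t · u_{yy} + u_{zz} + (tan t − cot t) u_t + V u = 0 with the exponential potential V(t,x,y,z) = μ₄ μ₅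 e^{−2x} / sin²t (= μ₄ μ₅ exp(−2(x + ln sin t))). -/
open Real

theorem pd_eq_aux {k : Fin 4} {f : (Fin 4 → ℝ) → ℝ} {p : Fin 4 → ℝ} {d : ℝ}
    (hf : DifferentiableAt ℝ f p)
    (h : HasDerivAt (fun s => f (Function.update p k s)) d (p k)) : pd k f p = d := by
  have h1 := hasDerivAt_update p k (p k)
  have h2 : HasFDerivAt f (fderiv ℝ f p) (Function.update p k (p k)) := by
    rw [Function.update_eq_self]; exact hf.hasFDerivAt
  exact (h2.comp_hasDerivAt (p k) h1).unique h

noncomputable def EE (L a b c : ℝ) (p : Fin 4 → ℝ) : ℝ :=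
  Real.exp (L * (p 1 + Real.log (Real.sin (p 0))) + (a * p 3 - Real.cos (p 0) / Real.sin (p 0) / 2 *
          (b * Real.exp (-(p 1 + p 2)) + c * Real.exp (-(p 1) + p 2))))

noncomputable def GG (L a b c : ℝ) (k : Fin 4) (p : Fin 4 → ℝ) : ℝ :=
  ![L * (Real.cos (p 0) / Real.sin (p 0)) + 
      1 / Real.sin (p 0) ^ 2 / 2 * (b * Real.exp (-(p 1 + p 2)) + c * Real.exp (-(p 1) + p 2)),
    L + Real.cos (p 0) / Real.sin (p 0) / 2 *
          (b * Real.exp (-(p 1 + p 2)) + c * Real.exp (-(p 1) + p 2)),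
    Real.cos (p 0) / Real.sin (p 0) / 2 *
          (b * Real.exp (-(p 1 + p 2)) - c * Real.exp (-(p 1) + p 2)),
    a] k

noncomputable def HH (L b c : ℝ) (k : Fin 4) (p : Fin 4 → ℝ) : ℝ :=
  ![- L / Real.sin (p 0) ^ 2 - Real.cos (p 0) / Real.sin (p 0) ^ 3 *
      (b * Real.exp (-(p 1 + p 2)) + c * Real.exp (-(p 1) + p 2)),
    - (Real.cos (p 0) / Real.sin (p 0) / 2 *
          (b * Real.exp (-(p 1 + p 2)) + c * Real.exp (-(p 1) + p 2))),
    - (Real.cos (p 0) / Real.sin (p 0) / 2 *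
          (b * Real.exp (-(p 1 + p 2)) + c * Real.exp (-(p 1) + p 2))),
    0] k

theorem EE_diff (L a b c : ℝ) (p : Fin 4 → ℝ) (hs : Real.sin (p 0) ≠ 0) :
    DifferentiableAt ℝ (EE L a b c) p := by
  unfold EE
  fun_prop (disch := assumption)

theorem GG_diff (L a b c : ℝ) (k : Fin 4) (p : Fin 4 → ℝ) (hs : Real.sin (p 0) ≠ 0) :
    DifferentiableAt ℝ (GG L a b c k) p := by
  have hs2 : Real.sin (p 0) ^ 2 ≠ 0 := pow_ne_zero _ hs
  unfold GG
  fin_cases k <;> simp <;> fun_prop (disch := assumption)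

theorem cot_der (t : ℝ) (hs : Real.sin t ≠ 0) :
    HasDerivAt (fun t => Real.cos t / Real.sin t) (-(1 / Real.sin t ^ 2)) t := by
  have := (Real.hasDerivAt_cos t).div (Real.hasDerivAt_sin t) hs
  refine this.congr_deriv ?_
  field_simp
  linarith [Real.sin_sq_add_cos_sq t]

theorem isq_der (t : ℝ) (hs : Real.sin t ≠ 0) :
    HasDerivAt (fun t => 1 / Real.sin t ^ 2) (-2 * Real.cos t / Real.sin t ^ 3) t := by
  have := (hasDerivAt_const t (1:ℝ)).div ((Real.hasDerivAt_sin t).pow 2) (pow_ne_zero 2 hs)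
  refine this.congr_deriv ?_
  simp
  field_simp

theorem exp1_der (x y : ℝ) :
    HasDerivAt (fun x => Real.exp (-(x + y))) (-Real.exp (-(x + y))) x := by
  have := ((hasDerivAt_id x).add_const y).neg.exp
  exact this.congr_deriv (by simp)
theorem exp2_der (x y : ℝ) :
    HasDerivAt (fun y => Real.exp (-(x + y))) (-Real.exp (-(x + y))) y := by
  have := ((hasDerivAt_id y).const_add x).neg.exp
  exact this.congr_deriv (by simp)
theorem exp3_der (x y : ℝ) :
    HasDerivAt (fun x => Real.exp (-x + y)) (-Real.exp (-x + y)) x := by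
  have := ((hasDerivAt_id x).neg.add_const y).exp
  exact this.congr_deriv (by simp)
theorem exp4_der (x y : ℝ) :
    HasDerivAt (fun y => Real.exp (-x + y)) (Real.exp (-x + y)) y := by
  have := ((hasDerivAt_id y).const_add (-x)).exp
  exact this.congr_deriv (by simp)

theorem EE_pd (L a b c : ℝ) (k : Fin 4) (p : Fin 4 → ℝ) (hs : Real.sin (p 0) ≠ 0) :
    pd k (EE L a b c) p = GG L a b c k p * EE L a b c p := by
  apply pd_eq_aux (EE_diff L a b c p hs)
  fin_cases k <;> simp [EE, GG, Function.update, -neg_add_rev]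
  · refine HasDerivAt.congr_deriv (HasDerivAt.exp ((((((Real.hasDerivAt_sin (p 0)).log hs).const_add
      (p 1)).const_mul L).add ((((cot_der _ hs).div_const 2).mul_const _).const_sub _)))) ?_
    ring
  · refine HasDerivAt.congr_deriv (HasDerivAt.exp ((((hasDerivAt_id (p 1)).add_const _).const_mul
      L).add (((((exp1_der (p 1) (p 2)).const_mul b).add
        ((exp3_der (p 1) (p 2)).const_mul c)).const_mul _).const_sub _))) ?_
    simp
    ring
  · refine HasDerivAt.congr_deriv (HasDerivAt.exp ((((((exp2_der (p 1) (p 2)).const_mul b).add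
        ((exp4_der (p 1) (p 2)).const_mul c)).const_mul _).const_sub _).const_add _)) ?_
    simp
    ring
  · refine HasDerivAt.congr_deriv (HasDerivAt.exp ((((hasDerivAt_id (p 3)).const_mul
      a).sub_const _).const_add _)) ?_
    simp
    ring

theorem GG_pd (L a b c : ℝ) (k : Fin 4) (p : Fin 4 → ℝ) (hs : Real.sin (p 0) ≠ 0) :
    pd k (GG L a b c k) p = HH L b c k p := by
  apply pd_eq_aux (GG_diff L a b c k p hs)
  fin_cases k <;> simp [HH, GG, Function.update, -neg_add_rev]
  · have h := ((cot_der _ hs).const_mul L).add (((isq_der _ hs).div_const 2).mul_const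
      (b * Real.exp (-(p 1 + p 2)) + c * Real.exp (-(p 1) + p 2)))
    simp only [one_div] at h
    refine h.congr_deriv ?_
    simp
    ring
  · have h := ((((exp1_der (p 1) (p 2)).const_mul b).add
        ((exp3_der (p 1) (p 2)).const_mul c)).const_mul 
          (Real.cos (p 0) / Real.sin (p 0) / 2))
    refine h.congr_deriv ?_
    ring
  · have h := (((exp2_der (p 1) (p 2)).const_mul b).sub
        ((exp4_der (p 1) (p 2)).const_mul c)).const_mul 
          (Real.cos (p 0) / Real.sin (p 0) / 2)
    refine h.congr_deriv ?_
    ring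
  · exact hasDerivAt_const _ _

theorem pd_congr_aux {k : Fin 4} {f g : (Fin 4 → ℝ) → ℝ} {p : Fin 4 → ℝ} 
    (hs : Real.sin (p 0) ≠ 0) (h : ∀ q : Fin 4 → ℝ, Real.sin (q 0) ≠ 0 → f q = g q) :
    pd k f p = pd k g p := by
  have : ∀ᶠ q in nhds p, Real.sin (q 0) ≠ 0 :=
    ContinuousAt.eventually_ne 
      (Real.continuous_sin.comp (continuous_apply 0)).continuousAt hs
  unfold pd
  rw [Filter.EventuallyEq.fderiv_eq (this.mono h)]

theorem EE_pd2 (L a b c : ℝ) (k : Fin 4) (p : Fin 4 → ℝ) (hs : Real.sin (p 0) ≠ 0) :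
    pd k (fun q => GG L a b c k q * EE L a b c q) p =
      (HH L b c k p + GG L a b c k p ^ 2) * EE L a b c p := by
  have h1 := GG_pd L a b c k p hs
  have h2 := EE_pd L a b c k p hs
  unfold pd at *
  rw [fderiv_fun_mul (GG_diff L a b c k p hs) (EE_diff L a b c p hs)]
  simp [h1, h2]
  ring

theorem pd_lin_s17 {k : Fin 4} {f g : (Fin 4 → ℝ) → ℝ} {p : Fin 4 → ℝ} (s t : ℝ)
    (hf : DifferentiableAt ℝ f p) (hg : DifferentiableAt ℝ g p) :
    pd k (fun q => s * f q + t * g q) p = s * pd k f p + t * pd k g p := by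
  unfold pd
  rw [fderiv_fun_add (hf.const_mul s) (hg.const_mul t), fderiv_const_mul hf, fderiv_const_mul hg]
  simp

theorem EE_pde (L a b c : ℝ) (hL : L ^ 2 + 2 * L + a ^ 2 = 0) (p : Fin 4 → ℝ)
    (hs : Real.sin (p 0) ≠ 0) (hc : Real.cos (p 0) ≠ 0) :
    -(HH L b c 0 p + GG L a b c 0 p ^ 2)
     + (Real.sin (p 0) ^ 2)⁻¹ * (HH L b c 1 p + GG L a b c 1 p ^ 2)
     + (Real.cos (p 0) ^ 2)⁻¹ * (HH L b c 2 p + GG L a b c 2 p ^ 2)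
     + (HH L b c 3 p + GG L a b c 3 p ^ 2)
     + (Real.tan (p 0) - Real.cot (p 0)) * GG L a b c 0 p
     + b * c * Real.exp (-(2 * p 1)) / Real.sin (p 0) ^ 2 = 0 := by
  have he : Real.exp (-(2 * p 1)) = Real.exp (-(p 1 + p 2)) * Real.exp (-(p 1) + p 2) := by
    rw [← Real.exp_add]; congr 1; ring
  have h1 := Real.sin_sq_add_cos_sq (p 0)
  rw [he, Real.tan_eq_sin_div_cos, Real.cot_eq_cos_div_sin]
  simp [HH, GG]
  rw [← neg_add_rev] 
  rw [add_comm (p 1) (p 2)]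
  generalize Real.exp (-(p 2 + p 1)) = A at *
  generalize Real.exp (-(p 1) + p 2) = B at *
  generalize Real.sin (p 0) = s at *
  generalize Real.cos (p 0) = C at *
  have hs2 : s ^ 2 = 1 - C ^ 2 := by linarith
  have ha : a ^ 2 = - L ^ 2 - 2 * L := by linarith
  rw [ha]
  field_simp
  grind

/-- with `λ± = −1 ± √(1−μ₃²)` and `ζ = x + ln sin t`, the function
`u = (σ₁e^{λ₊ζ} + σ₂e^{λ₋ζ}) exp(μ₃z − (cot t/2)(μ₄e^{−(x+y)} + μ₅e^{−x+y}))` solves the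
Klein–Gordon equation in `g = diag(−1, sin²t, cos²t, 1)` on `0 < t < π/2` with the exponential
potential `V = μ₄μ₅ e^{−2x}/sin²t`. -/
theorem stmt17 (μ₃ μ₄ μ₅ σ₁ σ₂ : ℝ) (hμ₃ : μ₃ ^ 2 ≤ 1)
    (u : (Fin 4 → ℝ) → ℝ)
    (hu : ∀ p : Fin 4 → ℝ,
      u p = (σ₁ * Real.exp ((-1 + Real.sqrt (1 - μ₃ ^ 2)) * (p 1 + Real.log (Real.sin (p 0))))
          + σ₂ * Real.exp ((-1 - Real.sqrt (1 - μ₃ ^ 2)) * (p 1 + Real.log (Real.sin (p 0))))) *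
        Real.exp (μ₃ * p 3 - Real.cot (p 0) / 2 *
          (μ₄ * Real.exp (-(p 1 + p 2)) + μ₅ * Real.exp (-(p 1) + p 2)))) :
    ∀ p : Fin 4 → ℝ, p 0 ∈ Set.Ioo 0 (π / 2) →
      -(pd 0 (pd 0 u) p) + (Real.sin (p 0) ^ 2)⁻¹ * pd 1 (pd 1 u) p
        + (Real.cos (p 0) ^ 2)⁻¹ * pd 2 (pd 2 u) p + pd 3 (pd 3 u) p
        + (Real.tan (p 0) - Real.cot (p 0)) * pd 0 u p
        + (μ₄ * μ₅ * Real.exp (-(2 * p 1)) / Real.sin (p 0) ^ 2) * u p = 0 := by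
  intro p hp
  have hsin : Real.sin (p 0) ≠ 0 :=
    (Real.sin_pos_of_pos_of_lt_pi hp.1 (by linarith [hp.2, Real.pi_pos])).ne'
  have hcos : Real.cos (p 0) ≠ 0 :=
    (Real.cos_pos_of_mem_Ioo ⟨by linarith [hp.1, Real.pi_pos], hp.2⟩).ne'
  have hr : Real.sqrt (1 - μ₃ ^ 2) ^ 2 = 1 - μ₃ ^ 2 := Real.sq_sqrt (by linarith)
  have hu' : u = fun q => σ₁ * EE (-1 + Real.sqrt (1 - μ₃ ^ 2)) μ₃ μ₄ μ₅ q
      + σ₂ * EE (-1 - Real.sqrt (1 - μ₃ ^ 2)) μ₃ μ₄ μ₅ q := by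
    funext q
    rw [hu, Real.cot_eq_cos_div_sin]
    simp only [EE, Real.exp_add ((_ : ℝ) * (_ + Real.log _))]
    ring
  have e1 := EE_pde (-1 + Real.sqrt (1 - μ₃ ^ 2)) μ₃ μ₄ μ₅ (by linear_combination hr) p hsin hcos
  have e2 := EE_pde (-1 - Real.sqrt (1 - μ₃ ^ 2)) μ₃ μ₄ μ₅ (by linear_combination hr) p hsin hcos
  generalize -1 + Real.sqrt (1 - μ₃ ^ 2) = L at *
  generalize -1 - Real.sqrt (1 - μ₃ ^ 2) = M at *
  have d1 : ∀ k, ∀ q : Fin 4 → ℝ, Real.sin (q 0) ≠ 0 → pd k u q =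
      σ₁ * (GG L μ₃ μ₄ μ₅ k q * EE L μ₃ μ₄ μ₅ q) + σ₂ * (GG M μ₃ μ₄ μ₅ k q * EE M μ₃ μ₄ μ₅ q) := by
    intro k q hq
    rw [hu', pd_lin_s17 _ _ (EE_diff _ _ _ _ q hq) (EE_diff _ _ _ _ q hq), EE_pd _ _ _ _ _ _ hq,
      EE_pd _ _ _ _ _ _ hq]
  have d2 : ∀ k, pd k (pd k u) p =
      σ₁ * ((HH L μ₄ μ₅ k p + GG L μ₃ μ₄ μ₅ k p ^ 2) * EE L μ₃ μ₄ μ₅ p)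
      + σ₂ * ((HH M μ₄ μ₅ k p + GG M μ₃ μ₄ μ₅ k p ^ 2) * EE M μ₃ μ₄ μ₅ p) := by
    intro k
    rw [pd_congr_aux hsin (d1 k), pd_lin_s17 _ _
      ((GG_diff _ _ _ _ _ p hsin).fun_mul (EE_diff _ _ _ _ p hsin))
      ((GG_diff _ _ _ _ _ p hsin).fun_mul (EE_diff _ _ _ _ p hsin)),
      EE_pd2 _ _ _ _ _ _ hsin, EE_pd2 _ _ _ _ _ _ hsin]
  rw [d2, d2, d2, d2, d1 0 p hsin, hu']
  linear_combination σ₁ * EE L μ₃ μ₄ μ₅ p * e1 + σ₂ * EE M μ₃ μ₄ μ₅ p * e2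
end
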